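/- Let a be a real number with 0 < a < (n−1)βΔ, and define f(x) := −(x_1 − a)² − ((t + nΔ)²/β²)·Σ_{i=2}^n x_i². Then the vector −u := (−t, 0, …, 0) is the unique minimizer of f over P̄ ∩ ℤⁿ, and the vector v := (t + (n−1)βΔ, β, β, …, β) is the unique minimizer of f over P̄. -/

import Mathlib

open scoped BigOperators

/-- The polytope `P̄` of Definition 1: `−t ≤ x₁ − Δ Σ_{i≥2} xᵢ ≤ t`, `0 ≤ xᵢ ≤ β` for
`i = 2, …, n` (here coordinates are indexed by `Fin n`, so `x₁` is `x ⟨0, hn⟩`). -/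
def Pbar (n : ℕ) (hn : 0 < n) (Δ t : ℤ) (β : ℝ) : Set (Fin n → ℝ) :=
  {x | -(t : ℝ) ≤ x ⟨0, hn⟩ -
        (Δ : ℝ) * ∑ i ∈ Finset.univ.filter (fun i : Fin n => 0 < (i : ℕ)), x i ∧
      x ⟨0, hn⟩ -
        (Δ : ℝ) * ∑ i ∈ Finset.univ.filter (fun i : Fin n => 0 < (i : ℕ)), x i ≤ (t : ℝ) ∧
      ∀ i : Fin n, 0 < (i : ℕ) → 0 ≤ x i ∧ x i ≤ β}

/-- The integer points of `ℝⁿ`. -/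
def intPts (n : ℕ) : Set (Fin n → ℝ) := {x | ∀ i, ∃ z : ℤ, x i = (z : ℝ)}

/-- The number of coordinates other than the first one, as a real number. -/
lemma card_filter_pos (n : ℕ) (hn : 0 < n) :
    ((Finset.univ.filter (fun i : Fin n => 0 < (i : ℕ))).card : ℝ) = (n : ℝ) - 1 := by
  obtain ⟨k, rfl⟩ := Nat.exists_eq_succ_of_ne_zero hn.ne'
  have h : (Finset.univ.filter (fun i : Fin (k + 1) => 0 < (i : ℕ))) =
      Finset.univ.erase 0 := by
    ext i
    simp only [Finset.mem_filter, Finset.mem_univ, true_and, Finset.mem_erase, and_true, ne_eq,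
      Fin.ext_iff, Fin.val_zero]
    omega
  rw [Nat.succ_eq_add_one, h, Finset.card_erase_of_mem (Finset.mem_univ _)]
  simp

/-- If the slack `D` in the cube constraints is positive, or the first coordinate is not extremal,
then the gain in the first squared term is beaten by the penalty `K² D / β`. -/
lemma sq_lt_sq_add_penalty {n Δ t β c D w : ℝ} (hn : 1 ≤ n) (hΔ : 1 ≤ Δ) (ht : 0 ≤ t)
    (hβ0 : 0 < β) (hβ1 : β < 1) (hc : 0 < c) (hD : 0 ≤ D) (hDn : D ≤ (n - 1) * β)
    (hw : w ≤ c + t - Δ * D) (hw' : -w ≤ Δ * D + t - c) (hne : D = 0 → w ≠ c + t) :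
    w ^ 2 < (c + t) ^ 2 + (t + n * Δ) ^ 2 * (D / β) := by
  have hΔD : 0 ≤ Δ * D := by positivity
  have hpen : 0 ≤ (t + n * Δ) ^ 2 * (D / β) := by positivity
  rcases lt_or_ge (-w) (c + t) with hlow | hlow
  · rcases hD.eq_or_lt with h0 | hpos
    · have hlt : w < c + t := lt_of_le_of_ne (by linarith) (hne h0.symm)
      nlinarith
    · have : 0 < Δ * D := by positivity
      nlinarith
  · have hDpos : 0 < D := by
      rcases hD.eq_or_lt with h0 | hpos
      · rw [← h0] at hw'
        linarith
      · exact hpos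
    have hgain : w ^ 2 - (c + t) ^ 2 < Δ * D * (Δ * D + 2 * t) := by
      have h1 : -w - (c + t) < Δ * D := by linarith
      have h2 : -w + (c + t) ≤ Δ * D + 2 * t := by linarith
      have h3 : 0 < -w + (c + t) := by linarith
      calc w ^ 2 - (c + t) ^ 2 = (-w - (c + t)) * (-w + (c + t)) := by ring
        _ < Δ * D * (-w + (c + t)) := mul_lt_mul_of_pos_right h1 h3
        _ ≤ Δ * D * (Δ * D + 2 * t) := mul_le_mul_of_nonneg_left h2 hΔD
    have hDn' : D ≤ n := by nlinarith
    have hK : Δ * β * (Δ * D + 2 * t) ≤ (t + n * Δ) ^ 2 := by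
      calc Δ * β * (Δ * D + 2 * t) ≤ Δ * n * (Δ * n + 2 * t) := by
            gcongr
            linarith
        _ ≤ (t + n * Δ) ^ 2 := by nlinarith [sq_nonneg t]
    have hfin : Δ * D * (Δ * D + 2 * t) ≤ (t + n * Δ) ^ 2 * (D / β) := by
      calc Δ * D * (Δ * D + 2 * t) = Δ * β * (Δ * D + 2 * t) * (D / β) := by field_simp
        _ ≤ _ := mul_le_mul_of_nonneg_right hK (by positivity)
    linarith

/-- **Lemma 4**: for `0 < a < (n−1)βΔ` and
`f(x) = −(x₁−a)² − ((t+nΔ)²/β²) Σ_{i≥2} xᵢ²`, the vector `−u = (−t, 0, …, 0)` is the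
unique minimizer of `f` over `P̄ ∩ ℤⁿ`, and `v = (t+(n−1)βΔ, β, …, β)` is the unique
minimizer of `f` over `P̄`. -/
theorem stmt10 (n : ℕ) (hn : 0 < n) (Δ t : ℤ) (hΔ : 1 ≤ Δ) (ht : 0 ≤ t)
    (β : ℝ) (hβ0 : 0 < β) (hβ1 : β < 1)
    (a : ℝ) (ha0 : 0 < a) (ha1 : a < ((n : ℝ) - 1) * β * (Δ : ℝ))
    (f : (Fin n → ℝ) → ℝ)
    (hf : ∀ x, f x = -(x ⟨0, hn⟩ - a) ^ 2 -
      (((t : ℝ) + (n : ℝ) * (Δ : ℝ)) ^ 2 / β ^ 2) *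
        ∑ i ∈ Finset.univ.filter (fun i : Fin n => 0 < (i : ℕ)), (x i) ^ 2)
    (mu v : Fin n → ℝ)
    (hmu : mu = fun i : Fin n => if (i : ℕ) = 0 then -(t : ℝ) else 0)
    (hv : v = fun i : Fin n =>
      if (i : ℕ) = 0 then (t : ℝ) + ((n : ℝ) - 1) * β * (Δ : ℝ) else β) :
    (mu ∈ Pbar n hn Δ t β ∩ intPts n ∧
      ∀ x ∈ Pbar n hn Δ t β ∩ intPts n, x ≠ mu → f mu < f x) ∧
    (v ∈ Pbar n hn Δ t β ∧ ∀ x ∈ Pbar n hn Δ t β, x ≠ v → f v < f x) := by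
  have hΔ' : (1 : ℝ) ≤ Δ := by exact_mod_cast hΔ
  have ht' : (0 : ℝ) ≤ t := by exact_mod_cast ht
  have hn' : (1 : ℝ) ≤ n := by exact_mod_cast hn
  have hcard := card_filter_pos n hn
  simp only [Pbar, Set.mem_inter_iff, Set.mem_ofPred_eq, intPts]
  set s := Finset.univ.filter (fun i : Fin n => 0 < (i : ℕ)) with hs
  have hmem : ∀ i ∈ s, 0 < (i : ℕ) := fun i hi => (Finset.mem_filter.1 hi).2
  have hmem' : ∀ i : Fin n, 0 < (i : ℕ) → i ∈ s := fun i hi => by simp [hs, hi]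
  have hmu0 : mu ⟨0, hn⟩ = -t := by simp [hmu]
  have hmui : ∀ i : Fin n, 0 < (i : ℕ) → mu i = 0 := fun i hi => by simp [hmu, hi.ne']
  have hv0 : v ⟨0, hn⟩ = t + ((n : ℝ) - 1) * β * Δ := by simp [hv]
  have hvi : ∀ i : Fin n, 0 < (i : ℕ) → v i = β := fun i hi => by
    simp only [hv, hi.ne', if_false]
  have hext : ∀ x y : Fin n → ℝ, x ⟨0, hn⟩ = y ⟨0, hn⟩ →
      (∀ i : Fin n, 0 < (i : ℕ) → x i = y i) → x = y := by
    intro x y h0 h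
    funext i
    rcases Nat.eq_zero_or_pos (i : ℕ) with hi | hi
    · rwa [show i = ⟨0, hn⟩ from Fin.ext hi]
    · exact h i hi
  have hsum_mu : ∑ i ∈ s, mu i = 0 := Finset.sum_eq_zero fun i hi => hmui i (hmem i hi)
  have hsum_v : ∑ i ∈ s, v i = ((n : ℝ) - 1) * β := by
    rw [Finset.sum_congr rfl fun i hi => hvi i (hmem i hi), Finset.sum_const, nsmul_eq_mul, hcard]
  have hsq_v : ∑ i ∈ s, v i ^ 2 = ((n : ℝ) - 1) * β ^ 2 := by
    rw [Finset.sum_congr rfl fun i hi => by rw [hvi i (hmem i hi)], Finset.sum_const,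
      nsmul_eq_mul, hcard]
  refine ⟨⟨⟨⟨?_, ?_, ?_⟩, ?_⟩, ?_⟩, ⟨?_, ?_, ?_⟩, ?_⟩
  · rw [hmu0, hsum_mu]
    linarith
  · rw [hmu0, hsum_mu]
    linarith
  · intro i hi
    rw [hmui i hi]
    exact ⟨le_rfl, hβ0.le⟩
  · intro i
    rcases Nat.eq_zero_or_pos (i : ℕ) with hi | hi
    · exact ⟨-t, by simp [hmu, hi]⟩
    · exact ⟨0, by simp [hmui i hi]⟩
  · rintro x ⟨⟨hl, hu, hb⟩, hint⟩ hne
    have hx : ∀ i : Fin n, 0 < (i : ℕ) → x i = 0 := by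
      intro i hi
      obtain ⟨z, hz⟩ := hint i
      obtain ⟨h0, h1⟩ := hb i hi
      rw [hz] at h0 h1 ⊢
      have hz0 : 0 ≤ z := by exact_mod_cast h0
      have hz1 : z < 1 := by exact_mod_cast h1.trans_lt hβ1
      have : z = 0 := by omega
      simp [this]
    rw [Finset.sum_eq_zero fun i hi => hx i (hmem i hi)] at hl hu
    have hsq : ∀ y : Fin n → ℝ, (∀ i : Fin n, 0 < (i : ℕ) → y i = 0) →
        ∑ i ∈ s, y i ^ 2 = 0 := fun y hy =>
      Finset.sum_eq_zero fun i hi => by rw [hy i (hmem i hi)]; ring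
    have hlt : -(t : ℝ) < x ⟨0, hn⟩ := by
      refine lt_of_le_of_ne (by linarith) fun h => hne (hext _ _ ?_ ?_)
      · rw [hmu0, h]
      · intro i hi
        rw [hx i hi, hmui i hi]
    rw [hf, hf, hsq _ hmui, hsq _ hx, hmu0]
    nlinarith
  · rw [hv0, hsum_v]
    linarith
  · rw [hv0, hsum_v]
    linarith
  · intro i hi
    rw [hvi i hi]
    exact ⟨hβ0.le, le_rfl⟩
  · rintro x ⟨hl, hu, hb⟩ hne
    have hslack : ∑ i ∈ s, (β - x i) = ((n : ℝ) - 1) * β - ∑ i ∈ s, x i := by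
      rw [Finset.sum_sub_distrib, Finset.sum_const, nsmul_eq_mul, hcard]
    have hnonneg : ∀ i ∈ s, 0 ≤ β - x i := fun i hi => by linarith [(hb i (hmem i hi)).2]
    have hsum0 : 0 ≤ ∑ i ∈ s, x i := Finset.sum_nonneg fun i hi => (hb i (hmem i hi)).1
    have hsq : ∑ i ∈ s, x i ^ 2 ≤ β * ∑ i ∈ s, x i := by
      rw [Finset.mul_sum]
      refine Finset.sum_le_sum fun i hi => ?_
      obtain ⟨h0, h1⟩ := hb i (hmem i hi)
      nlinarith
    have key := sq_lt_sq_add_penalty (c := ((n : ℝ) - 1) * β * Δ - a)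
      (D := ∑ i ∈ s, (β - x i)) (w := x ⟨0, hn⟩ - a) hn' hΔ' ht' hβ0 hβ1 (by linarith)
      (Finset.sum_nonneg hnonneg) (by linarith) (by rw [hslack]; linarith)
      (by rw [hslack]; linarith) (by
        intro hD hw
        refine hne (hext _ _ (by rw [hv0]; linarith) fun i hi => ?_)
        rw [hvi i hi]
        linarith [(Finset.sum_eq_zero_iff_of_nonneg hnonneg).1 hD i (hmem' i hi)])
    rw [hslack] at key
    rw [hf, hf, hv0, hsq_v]
    have hpen : ((t : ℝ) + n * Δ) ^ 2 / β ^ 2 * ∑ i ∈ s, x i ^ 2 ≤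
        ((t : ℝ) + n * Δ) ^ 2 / β ^ 2 * (β * ∑ i ∈ s, x i) :=
      mul_le_mul_of_nonneg_left hsq (by positivity)
    have hsplit : ((t : ℝ) + n * Δ) ^ 2 * ((((n : ℝ) - 1) * β - ∑ i ∈ s, x i) / β) =
        ((t : ℝ) + n * Δ) ^ 2 / β ^ 2 * (((n : ℝ) - 1) * β ^ 2) -
          ((t : ℝ) + n * Δ) ^ 2 / β ^ 2 * (β * ∑ i ∈ s, x i) := by
      field_simp
    have hfirst : (t + ((n : ℝ) - 1) * β * Δ - a) ^ 2 =
        (((n : ℝ) - 1) * β * Δ - a + t) ^ 2 := by ring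
    linarith
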